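/- For every integer k ≥ 1, let Λ_k be the k×k upper-triangular matrix over ℚ whose (m, i)-entry is λ_{i-1,m} for 1 ≤ m ≤ i ≤ k and 0 for m > i. Then Λ_k is invertible, and its inverse is the k×k upper-triangular matrix whose (i, j)-entry is (-1)^{i+j} · a_{j,i-1} for 1 ≤ i ≤ j ≤ k and 0 for i > j. -/

import Mathlib

/-- The Stirling numbers of the second kind, via the explicit formula. -/
def S (n m : ℕ) : ℚ :=
  (1 / (m.factorial : ℚ)) *
    ∑ ℓ ∈ Finset.range (m + 1), (-1 : ℚ) ^ (m - ℓ) * (m.choose ℓ : ℚ) * (ℓ : ℚ) ^ n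

/-- The coefficients `λ_{i,m} = (-1)^i (m-1)! S(i+1, m)`. -/
def lam (i m : ℕ) : ℚ := (-1 : ℚ) ^ i * ((m - 1).factorial : ℚ) * S (i + 1) m

/-- The `(k-i+1) × (k-i+1)` matrix `M(k,i)`: for `r c : Fin (k-i+1)` (zero-indexed, so the
row is `r+1` and the column `c+1` in the one-indexed description), the first-column entry
is `(1/(i+r-1)!) ⬝ C(k, i+r)` and the entry in a later column `c` is `S(i+c, i+r)`. -/
def M (k i : ℕ) : Matrix (Fin (k - i + 1)) (Fin (k - i + 1)) ℚ := fun r c =>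
  if c.val = 0 then (1 / ((i + r.val - 1).factorial : ℚ)) * (k.choose (i + r.val) : ℚ)
  else S (i + c.val) (i + r.val)

/-- The coefficient `a_{k,i-1} = (-1)^{i+1} det M(k,i)`; here `a k i` stands for
the quantity denoted `a_{k,i-1}` (so `i` runs from `1` to `k`). -/
def a (k i : ℕ) : ℚ := (-1 : ℚ) ^ (i + 1) * (M k i).det

/-- The upper-triangular matrix `Λ_k` whose one-indexed `(m, i)` entry is
`λ_{i-1,m}` for `m ≤ i` and `0` otherwise (zero-indexed below). -/
def Lam (k : ℕ) : Matrix (Fin k) (Fin k) ℚ := fun m i =>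
  if m.val ≤ i.val then lam i.val (m.val + 1) else 0

open Finset in
theorem S_rec (n m : ℕ) : S (n + 1) (m + 1) = (m + 1) * S n (m + 1) + S n m := by
  have hm : (m.factorial : ℚ) ≠ 0 := by exact_mod_cast m.factorial_ne_zero
  have hm1 : (m : ℚ) + 1 ≠ 0 := by positivity
  have key : ∑ l ∈ range (m + 1 + 1), (-1 : ℚ) ^ (m + 1 - l) * ((m + 1).choose l : ℚ) * (l : ℚ) ^ (n + 1)
      = (m + 1) * (∑ l ∈ range (m + 1 + 1), (-1 : ℚ) ^ (m + 1 - l) * ((m + 1).choose l : ℚ) * (l : ℚ) ^ n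
        + ∑ l ∈ range (m + 1), (-1 : ℚ) ^ (m - l) * (m.choose l : ℚ) * (l : ℚ) ^ n) := by
    rw [sum_range_succ, sum_range_succ (n := m + 1), add_right_comm, ← sum_add_distrib, mul_add, mul_sum]
    congr 1
    · apply sum_congr rfl
      intro l hl
      have hl' : l ≤ m := by simpa [Nat.lt_succ_iff] using hl
      have e : m + 1 - l = (m - l) + 1 := by omega
      have h : ((m : ℚ) + 1) * m.choose l = (m + 1).choose l * (m + 1 - l) := by
        have h0 := Nat.choose_mul_succ_eq m l
        have h2 : ((m + 1 - l : ℕ) : ℚ) = m + 1 - l := by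
          rw [Nat.cast_sub (by omega)]; push_cast; ring
        rw [← h2, mul_comm]
        exact_mod_cast h0
      rw [e]
      linear_combination (-(-1 : ℚ) ^ (m - l) * (l : ℚ) ^ n) * h
    · push_cast
      simp
      ring
  unfold S
  rw [key, Nat.factorial_succ]
  push_cast
  field_simp

theorem S_zero_left (m : ℕ) : S 0 (m + 1) = 0 := by
  have h := add_pow (1 : ℚ) (-1) (m + 1)
  unfold S
  simp only [pow_zero, mul_one]
  simp at h
  simp [← h]

theorem S_zero_zero : S 0 0 = 1 := by simp [S]

theorem S_succ_zero (n : ℕ) : S (n + 1) 0 = 0 := by simp [S]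

theorem S_eq (n m : ℕ) : S n m = Nat.stirlingSecond n m := by
  induction n generalizing m with
  | zero => cases m <;> simp [S_zero_zero, S_zero_left]
  | succ n ih =>
    cases m with
    | zero => simp [S_succ_zero]
    | succ m => rw [S_rec, ih, ih, Nat.stirlingSecond_succ_succ]; push_cast; ring

def GG (e : ℚ) (k m : ℕ) : ℚ :=
  ∑ l ∈ Finset.range (k + 1), e ^ l * (Nat.stirlingFirst k l : ℚ) * S l m

theorem GG_zero (e : ℚ) (m : ℕ) : GG e 0 m = S 0 m := by simp [GG]

theorem GG_succ_zero (e : ℚ) (k : ℕ) : GG e (k + 1) 0 = 0 := by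
  unfold GG
  rw [Finset.sum_range_succ']
  simp [S_succ_zero]

theorem GG_rec (e : ℚ) (k m : ℕ) : GG e (k + 1) (m + 1) =
    k * GG e k (m + 1) + e * ((m + 1) * GG e k (m + 1) + GG e k m) := by
  have h1 : GG e k (m + 1) = ∑ l ∈ Finset.range (k + 1),
      e ^ (l + 1) * (Nat.stirlingFirst k (l + 1) : ℚ) * S (l + 1) (m + 1) := by
    have := Finset.sum_range_succ' (fun l => e ^ l * (Nat.stirlingFirst k l : ℚ) * S l (m + 1)) (k + 1)
    rw [Finset.sum_range_succ] at this
    simp only [Nat.stirlingFirst_eq_zero_of_lt (Nat.lt_succ_self k), S_zero_left] at this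
    simpa [GG] using this
  conv_rhs => enter [1]; rw [h1]
  unfold GG
  rw [Finset.sum_range_succ']
  simp only [S_zero_left, mul_zero, add_zero, Finset.mul_sum, ← Finset.sum_add_distrib]
  apply Finset.sum_congr rfl
  intro l _
  rw [Nat.stirlingFirst_succ_succ, S_rec]
  push_cast
  ring

theorem GG_neg (k m : ℕ) : GG (-1) k m = if k = m then (-1) ^ k else 0 := by
  induction k generalizing m with
  | zero => rw [GG_zero]; cases m <;> simp [S_zero_zero, S_zero_left]
  | succ k ih =>
    cases m with
    | zero => simp [GG_succ_zero]
    | succ m =>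
      rw [GG_rec, ih, ih]
      by_cases h : k = m
      · subst h; simp [pow_succ]
      · by_cases h2 : k = m + 1
        · subst h2; simp
        · simp [h, h2]

theorem GG_one (k m : ℕ) : GG 1 (k + 1) (m + 1) * m.factorial = (k + 1).choose (m + 1) * k.factorial := by
  induction k generalizing m with
  | zero =>
    rw [GG_rec, GG_zero, GG_zero, S_zero_left]
    cases m <;> simp [S_zero_zero, S_zero_left, Nat.choose]
  | succ k ih =>
    rw [GG_rec]
    cases m with
    | zero =>
      have := ih 0
      rw [GG_succ_zero]
      simp [Nat.factorial_succ] at this ⊢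
      rw [this]; ring
    | succ m =>
      have i1 := ih (m + 1)
      have i2 := ih m
      have c1 : ((k : ℚ) + 1) * k.choose (m + 1) = (k + 1).choose (m + 2) * (m + 2) := by
        exact_mod_cast Nat.add_one_mul_choose_eq k (m + 1)
      have c2 : ((k : ℚ) + 1) * k.choose m = (k + 1).choose (m + 1) * (m + 1) := by
        exact_mod_cast Nat.add_one_mul_choose_eq k m
      have c3 : ((k + 1).choose (m + 1) : ℚ) = k.choose m + k.choose (m + 1) := by
        exact_mod_cast Nat.choose_succ_succ k m
      have c4 : ((k + 1 + 1).choose (m + 1 + 1) : ℚ) = (k + 1).choose (m + 1) + (k + 1).choose (m + 2) := by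
        exact_mod_cast Nat.choose_succ_succ (k + 1) (m + 1)
      rw [c4]
      simp only [Nat.factorial_succ] at *
      push_cast at *
      linear_combination (k + m + 3 : ℚ) * i1 + (m + 1 : ℚ) * i2 - (k.factorial : ℚ) * (c1 + c2 + (k + 1) * c3)

theorem det_M (k i : ℕ) (h : i ≤ k) :
    (M (k + 1) (i + 1)).det = (Nat.stirlingFirst (k + 1) (i + 1) : ℚ) / k.factorial := by
  set n := k + 1 - (i + 1) + 1 with hn
  let T : Matrix (Fin n) (Fin n) ℚ := fun r c => S (i + 1 + c.val) (i + 1 + r.val)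
  let x : Fin n → ℚ := fun c => (Nat.stirlingFirst (k + 1) (i + 1 + c.val) : ℚ) / k.factorial
  have hk : (k.factorial : ℚ) ≠ 0 := by exact_mod_cast k.factorial_ne_zero
  have hT : T.det = 1 := by
    rw [Matrix.det_of_isUpperTriangular]
    · exact Finset.prod_eq_one (fun c _ => by simp only [T, S_eq, Nat.stirlingSecond_self, Nat.cast_one])
    · intro r c hrc
      have : c.val < r.val := hrc
      simp only [T, S_eq]
      rw [Nat.stirlingSecond_eq_zero_of_lt (by omega)]; simp
  have hM : M (k + 1) (i + 1) = T.updateCol 0 (T.mulVec x) := by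
    ext r c
    rw [Matrix.updateCol_apply]
    by_cases hc : c = 0
    · subst hc
      simp only [M, Matrix.mulVec, dotProduct, T, x]
      have hG := GG_one k (i + r.val)
      have e : k + 1 + 1 = (i + 1) + n := by omega
      unfold GG at hG
      rw [e, Finset.sum_range_add, Finset.sum_eq_zero, zero_add, Finset.sum_range] at hG
      · have hf : ((i + r.val).factorial : ℚ) ≠ 0 := by exact_mod_cast (i + r.val).factorial_ne_zero
        have e2 : i + 1 + r.val = i + r.val + 1 := by omega
        rw [if_pos (by simp), if_pos trivial]
        simp only [e2, Nat.add_sub_cancel, mul_div_assoc', ← Finset.sum_div]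
        rw [eq_div_iff hk, one_div, inv_mul_eq_div, div_mul_eq_mul_div, div_eq_iff hf, ← hG]
        congr 1
        apply Finset.sum_congr rfl
        intro l _
        simp; ring
      · intro l hl
        have := Finset.mem_range.1 hl
        rw [S_eq, Nat.stirlingSecond_eq_zero_of_lt (by omega)]; simp
    · have : c.val ≠ 0 := fun h => hc (Fin.ext h)
      simp [M, T, hc, this]
  rw [hM, ← Matrix.cramer_apply, Matrix.cramer_eq_adjugate_mulVec, Matrix.mulVec_mulVec,
    Matrix.adjugate_mul, hT]
  simp [x]

theorem Lam_isUnit_and_inv (k : ℕ) (hk : 1 ≤ k) :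
    IsUnit (Lam k) ∧
      (Lam k)⁻¹ = fun i j : Fin k =>
        if i.val ≤ j.val then (-1 : ℚ) ^ (i.val + j.val) * a (j.val + 1) (i.val + 1)
        else 0 := by
  have key : Lam k * (show Matrix (Fin k) (Fin k) ℚ from fun i j : Fin k =>
        if i.val ≤ j.val then (-1 : ℚ) ^ (i.val + j.val) * a (j.val + 1) (i.val + 1)
        else 0) = 1 := by
    ext m j
    rw [Matrix.mul_apply]
    have hf : (j.val.factorial : ℚ) ≠ 0 := by exact_mod_cast j.val.factorial_ne_zero
    have h1 : ∀ i : Fin k, Lam k m i * (if i.val ≤ j.val then (-1 : ℚ) ^ (i.val + j.val) * a (j.val + 1) (i.val + 1)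
        else 0) = (fun l : ℕ => (-1 : ℚ) ^ (j.val + 1) * m.val.factorial / j.val.factorial *
          ((-1) ^ (l + 1) * (Nat.stirlingFirst (j.val + 1) (l + 1) : ℚ) * S (l + 1) (m.val + 1))) i.val := by
      intro i
      have hL : Lam k m i = lam i.val (m.val + 1) := by
        unfold Lam
        split_ifs with h
        · rfl
        · rw [lam, S_eq, Nat.stirlingSecond_eq_zero_of_lt (by omega)]; simp
      rw [hL]
      split_ifs with h
      · rw [a, det_M _ _ h, lam]
        have : (-1 : ℚ) ^ i.val * (-1) ^ i.val = 1 := by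
          rw [← mul_pow]; simp
        simp only [pow_add, Nat.add_sub_cancel]
        field_simp
        linear_combination (S (i.val + 1) (m.val + 1) * Nat.stirlingFirst (j.val + 1) (i.val + 1)) * this
      · simp only []
        rw [Nat.stirlingFirst_eq_zero_of_lt (by omega)]; simp
    refine ((Finset.sum_congr rfl (fun i _ => h1 i)).trans (Fin.sum_univ_eq_sum_range
      (fun l : ℕ => (-1 : ℚ) ^ (j.val + 1) * m.val.factorial / j.val.factorial *
          ((-1) ^ (l + 1) * (Nat.stirlingFirst (j.val + 1) (l + 1) : ℚ) * S (l + 1) (m.val + 1))) k)).trans ?_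
    rw [← Finset.mul_sum]
    have h2 := GG_neg (j.val + 1) (m.val + 1)
    unfold GG at h2
    rw [Finset.sum_range_succ'] at h2
    simp only [Nat.stirlingFirst_succ_zero, Nat.cast_zero, mul_zero, zero_mul, add_zero] at h2
    rw [← Finset.sum_subset (Finset.range_subset_range.2 (show j.val + 1 ≤ k from j.isLt)), h2]
    · rw [Matrix.one_apply]
      by_cases h : m = j
      · subst h
        have : (-1 : ℚ) ^ (m.val + 1) * (-1) ^ (m.val + 1) = 1 := by
          rw [← mul_pow]; simp
        simp only [if_true]
        field_simp
        linear_combination this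
      · have : ¬ (j.val + 1 = m.val + 1) := fun h' => h (Fin.ext (by omega))
        rw [if_neg this, if_neg h, mul_zero]
    · intro l _ hl
      have : ¬ l < j.val + 1 := fun h => hl (Finset.mem_range.2 h)
      rw [Nat.stirlingFirst_eq_zero_of_lt (by omega)]; simp
  refine ⟨?_, Matrix.inv_eq_right_inv key⟩
  rw [Matrix.isUnit_iff_isUnit_det]
  exact Matrix.isUnit_det_of_right_inverse key
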